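/- Let 𝓕 = (S, I, R, f, f₁) be a frame and let 𝒫 = (P, Q, F, F₁) be a window over 𝓕. Then F₁ determines F: if t ∈ S ⊗_{f,S} I satisfies f₁^♯(t) = 1, then F(x) = F₁^♯(t·x) for all x ∈ P, where t·x denotes the image of t ⊗ x under the natural map (S ⊗_{f,S} I) ⊗ P → S ⊗_{f,S} Q. In particular, F(x) = π·F₁(x) for all x ∈ Q, where π ∈ S is the unique element with f(a) = π·f₁(a) for a ∈ I; consequently, if (P, Q, F, F₁) and (P, Q, F', F₁) are windows over 𝓕 with the same F₁, then F = F'. -/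

import Mathlib

open scoped BigOperators

/-- A frame `(S, I, R, f, f₁)` (with `R = S ⧸ I` implicit):
`S` is a local ring, `I ⊆ S` an ideal, `f` a ring endomorphism of `S`,
`f₁ : I → S` an `f`-linear map such that `f₁(I)` generates `S` as an `S`-module. -/
structure Frame (S : Type) [CommRing S] where
  isLocal : IsLocalRing S
  I : Ideal S
  f : S →+* S
  f₁ : I →ₛₗ[f] S
  span_f₁ : Ideal.span (Set.range ⇑f₁) = ⊤

/-- A window `(P, Q, F, F₁)` over a frame. -/
structure IsWindow {S : Type} [CommRing S] (𝓕 : Frame S)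
    {P : Type} [AddCommGroup P] [Module S P] [Module.Free S P] [Module.Finite S P]
    (Q : Submodule S P) (F : P →ₛₗ[𝓕.f] P) (F₁ : Q →ₛₗ[𝓕.f] P) : Prop where
  smul_le : 𝓕.I • (⊤ : Submodule S P) ≤ Q
  quot_free : ∃ n : ℕ, Nonempty ((P ⧸ Q) ≃ₗ[S] (Fin n → S ⧸ 𝓕.I))
  F₁_smul : ∀ (a : 𝓕.I) (x : P),
    F₁ ⟨(a : S) • x, smul_le (Submodule.smul_mem_smul a.2 Submodule.mem_top)⟩
      = 𝓕.f₁ a • F x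
  span_F₁ : Submodule.span S (Set.range ⇑F₁) = ⊤

theorem Frame.eq_of_forall_f₁_smul_eq {S : Type} [CommRing S] (𝓕 : Frame S)
    {M : Type*} [AddCommGroup M] [Module S M] {m m' : M}
    (h : ∀ b : 𝓕.I, 𝓕.f₁ b • m = 𝓕.f₁ b • m') : m = m' := by
  have hle : Ideal.span (Set.range ⇑𝓕.f₁) ≤
      LinearMap.eqLocus (LinearMap.toSpanSingleton S M m) (LinearMap.toSpanSingleton S M m') := by
    refine Ideal.span_le.mpr ?_
    rintro _ ⟨b, rfl⟩
    exact h b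
  have h1 : (1 : S) ∈ Ideal.span (Set.range ⇑𝓕.f₁) := by simp [𝓕.span_f₁]
  simpa using hle h1

/-- In a window, `F₁` determines `F`:
if `t = ∑ sᵢ ⊗ aᵢ` satisfies `f₁^♯(t) = 1`, then `F(x) = F₁^♯(t·x) = ∑ sᵢ • F₁(aᵢ • x)`;
in particular `F(x) = π • F₁(x)` for `x ∈ Q`, and two windows over `𝓕` with the same
`(P, Q, F₁)` have the same `F`. -/
theorem window_F_determined_by_F₁ {S : Type} [CommRing S] (𝓕 : Frame S)
    {P : Type} [AddCommGroup P] [Module S P] [Module.Free S P] [Module.Finite S P]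
    (Q : Submodule S P) (F : P →ₛₗ[𝓕.f] P) (F₁ : Q →ₛₗ[𝓕.f] P)
    (hW : IsWindow 𝓕 Q F F₁) :
    (∀ (n : ℕ) (s : Fin n → S) (a : Fin n → 𝓕.I),
      (∑ i, s i * 𝓕.f₁ (a i)) = 1 →
      ∀ x : P, F x = ∑ i, s i •
        F₁ ⟨((a i : S)) • x, hW.smul_le (Submodule.smul_mem_smul (a i).2 Submodule.mem_top)⟩) ∧
    (∀ π : S, (∀ b : 𝓕.I, 𝓕.f b = π * 𝓕.f₁ b) → ∀ x : Q, F x = π • F₁ x) ∧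
    (∀ F' : P →ₛₗ[𝓕.f] P, IsWindow 𝓕 Q F' F₁ → F' = F) := by
  refine ⟨fun n s a h x => ?_, fun π hπ x => ?_, fun F' hW' => ?_⟩
  · simp_rw [hW.F₁_smul, smul_smul]
    rw [← Finset.sum_smul, h, one_smul]
  · refine 𝓕.eq_of_forall_f₁_smul_eq fun b => ?_
    rw [← hW.F₁_smul, smul_smul, mul_comm, ← hπ]
    exact F₁.map_smulₛₗ (b : S) x
  · ext x
    refine 𝓕.eq_of_forall_f₁_smul_eq fun b => ?_
    rw [← hW.F₁_smul, ← hW'.F₁_smul]
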